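/- arXiv:1910.04043 — 16 statements merged into one kernel-verified Lean document; each statement's English description precedes it below -/
import Mathlib

section
/- For every integer n ≥ 1, (a/b)^{ζ(n)}·u_n² − (a/b)^{ζ(n+1)}·u_{n−1}·u_{n+1} = (a/b)·(−c)^{n−1}. -/
theorem stmt_0 (a b c : ℝ) (ha : a ≠ 0) (hb : b ≠ 0) (hc : c ≠ 0)
    (u : ℕ → ℝ) (hu0 : u 0 = 0) (hu1 : u 1 = 1)
    (hu : ∀ n : ℕ, 2 ≤ n → u n = (if Even n then a else b) * u (n - 1) + c * u (n - 2))
    (n : ℕ) (hn : 1 ≤ n) :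
    (a / b) ^ (n % 2) * u n ^ 2 - (a / b) ^ ((n + 1) % 2) * u (n - 1) * u (n + 1) =
      (a / b) * (-c) ^ (n - 1) := by
  have he : ∀ k : ℕ, u (2 * k + 2) = a * u (2 * k + 1) + c * u (2 * k) := by
    intro k
    have h := hu (2 * k + 2) (by omega)
    rw [if_pos ⟨k + 1, by ring⟩] at h
    exact h
  have ho : ∀ k : ℕ, u (2 * k + 3) = b * u (2 * k + 2) + c * u (2 * k + 1) := by
    intro k
    have h := hu (2 * k + 3) (by omega)
    rw [if_neg (by rw [Nat.even_iff]; omega)] at h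
    exact h
  have step : ∀ k : ℕ, b * u (2 * k + 2) ^ 2 - a * u (2 * k + 1) * u (2 * k + 3)
      = -c * (a * u (2 * k + 1) ^ 2 - b * u (2 * k) * u (2 * k + 2)) := by
    intro k
    rw [ho k, he k]
    ring
  have main : ∀ k : ℕ, a * u (2 * k + 1) ^ 2 - b * u (2 * k) * u (2 * k + 2)
      = a * (-c) ^ (2 * k) := by
    intro k
    induction k with
    | zero => simp [hu0, hu1]
    | succ k ih =>
      have h1 := step k
      rw [ih] at h1
      have h2 := he (k + 1)
      rw [show 2 * (k + 1) + 2 = 2 * k + 4 by ring, show 2 * (k + 1) + 1 = 2 * k + 3 by ring,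
        show 2 * (k + 1) = 2 * k + 2 by ring] at *
      rw [h2, pow_add]
      have h3 := ho k
      linear_combination (-c) * h1 + a * u (2 * k + 3) * h3
  obtain ⟨m, rfl⟩ : ∃ m, n = m + 1 := ⟨n - 1, by omega⟩
  obtain ⟨k, rfl | rfl⟩ := Nat.even_or_odd' m
  · have h := main k
    rw [show (2 * k + 1) % 2 = 1 by omega, show (2 * k + 1 + 1) % 2 = 0 by omega]
    simp only [Nat.add_sub_cancel, pow_one, pow_zero, one_mul]
    rw [show 2 * k + 1 + 1 = 2 * k + 2 by ring]
    field_simp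
    linear_combination h
  · have h := step k
    rw [main k] at h
    rw [show (2 * k + 1 + 1) % 2 = 0 by omega, show (2 * k + 1 + 1 + 1) % 2 = 1 by omega]
    simp only [Nat.add_sub_cancel, pow_one, pow_zero, one_mul]
    rw [show 2 * k + 1 + 1 + 1 = 2 * k + 3 by ring, show 2 * k + 1 + 1 = 2 * k + 2 by ring, pow_succ]
    field_simp
    linear_combination h
end

section
/- For all integers m ≥ 1 and n ≥ 0, (b/a)^{ζ(mn+n)}·u_m·u_{n+1} + (b/a)^{ζ(mn+m)}·c·u_n·u_{m−1} = u_{n+m}. -/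
theorem stmt_1 (a b c : ℝ) (ha : a ≠ 0) (hb : b ≠ 0) (hc : c ≠ 0)
    (u : ℕ → ℝ) (hu0 : u 0 = 0) (hu1 : u 1 = 1)
    (hu : ∀ n : ℕ, 2 ≤ n → u n = (if Even n then a else b) * u (n - 1) + c * u (n - 2))
    (m n : ℕ) (hm : 1 ≤ m) :
    (b / a) ^ ((m * n + n) % 2) * u m * u (n + 1) +
      (b / a) ^ ((m * n + m) % 2) * c * u n * u (m - 1) = u (n + m) := by
  have he : ∀ k, u (2 * k + 2) = a * u (2 * k + 1) + c * u (2 * k) := by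
    intro k
    have h := hu (2 * k + 2) (by omega)
    rw [if_pos (by simp [Nat.even_add])] at h
    exact h
  have ho : ∀ k, u (2 * k + 3) = b * u (2 * k + 2) + c * u (2 * k + 1) := by
    intro k
    have h := hu (2 * k + 3) (by omega)
    rw [if_neg (by rw [Nat.even_iff]; omega)] at h
    exact h
  obtain ⟨r, hr⟩ : ∃ r, r = b / a := ⟨_, rfl⟩
  have hra : b = r * a := by rw [hr]; field_simp
  rw [← hr]
  have h1 : ∀ j k, u (2 * (j + k) + 1) = u (2 * k + 1) * u (2 * j + 1) + r * c * u (2 * j) * u (2 * k)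
      ∧ u (2 * (j + k) + 2) = u (2 * k + 2) * u (2 * j + 1) + c * u (2 * j) * u (2 * k + 1) := by
    intro j k
    induction k with
    | zero =>
      have := he j
      have h2 := he 0
      simp [hu0, hu1] at *
      rw [this, h2]
    | succ k ih =>
      obtain ⟨i1, i2⟩ := ih
      have e1 := ho (j + k)
      have e2 := he (j + k + 1)
      have e3 := ho k
      have e4 := he (k + 1)
      have e5 := he k
      simp only [← add_assoc, mul_add, mul_one] at *
      have g : u (2 * j + 2 * k + 3) = u (2 * k + 3) * u (2 * j + 1) + r * c * u (2 * j) * u (2 * k + 2) := by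
        rw [e1, i1, i2, e3, e5, hra]; ring
      refine ⟨g, ?_⟩
      rw [e2, e4]
      change a * u (2 * j + 2 * k + 3) + _ = (a * u (2 * k + 3) + _) * _ + c * _ * u (2 * k + 3)
      rw [g, i2, e3, hra]; ring
  have h2 : ∀ j k, u (2 * (j + k) + 3) = r * u (2 * k + 2) * u (2 * j + 2) + c * u (2 * j + 1) * u (2 * k + 1) := by
    intro j k
    rw [ho, (h1 j k).1, (h1 j k).2, he j, he k, hra]; ring
  have h3 : ∀ j k, u (2 * (j + k) + 2) = u (2 * k + 1) * u (2 * j + 2) + c * u (2 * j + 1) * u (2 * k) := by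
    intro j k
    rw [(h1 j k).2, he j, he k]; ring
  obtain ⟨m, rfl⟩ : ∃ k, m = k + 1 := ⟨m - 1, by omega⟩
  rw [Nat.add_sub_cancel]
  obtain ⟨k, rfl | rfl⟩ := Nat.even_or_odd' m <;> obtain ⟨j, rfl | rfl⟩ := Nat.even_or_odd' n
  · rw [show ((2 * k + 1) * (2 * j) + 2 * j) % 2 = 0 by ring_nf; omega,
      show ((2 * k + 1) * (2 * j) + (2 * k + 1)) % 2 = 1 by ring_nf; omega,
      show 2 * j + (2 * k + 1) = 2 * (j + k) + 1 by ring, (h1 j k).1]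
    ring
  · rw [show ((2 * k + 1) * (2 * j + 1) + (2 * j + 1)) % 2 = 0 by ring_nf; omega,
      show ((2 * k + 1) * (2 * j + 1) + (2 * k + 1)) % 2 = 0 by ring_nf; omega,
      show 2 * j + 1 + (2 * k + 1) = 2 * (j + k) + 2 by ring, h3 j k]
    ring
  · rw [show ((2 * k + 1 + 1) * (2 * j) + 2 * j) % 2 = 0 by ring_nf; omega,
      show ((2 * k + 1 + 1) * (2 * j) + (2 * k + 1 + 1)) % 2 = 0 by ring_nf; omega,
      show 2 * j + (2 * k + 1 + 1) = 2 * (j + k) + 2 by ring, (h1 j k).2]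
    ring
  · rw [show ((2 * k + 1 + 1) * (2 * j + 1) + (2 * j + 1)) % 2 = 1 by ring_nf; omega,
      show ((2 * k + 1 + 1) * (2 * j + 1) + (2 * k + 1 + 1)) % 2 = 0 by ring_nf; omega,
      show 2 * j + 1 + (2 * k + 1 + 1) = 2 * (j + k) + 3 by ring, h2 j k]
    ring
end

section
/- For all integers n ≥ m ≥ 1, (b/a)^{ζ(mn+n)}·u_m·u_{n−m+1} + c·(b/a)^{ζ(mn)}·u_{m−1}·u_{n−m} = u_n. -/
theorem stmt_3 (a b c : ℝ) (ha : a ≠ 0) (hb : b ≠ 0) (hc : c ≠ 0)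
    (u : ℕ → ℝ) (hu0 : u 0 = 0) (hu1 : u 1 = 1)
    (hu : ∀ n : ℕ, 2 ≤ n → u n = (if Even n then a else b) * u (n - 1) + c * u (n - 2))
    (m n : ℕ) (hm : 1 ≤ m) (hmn : m ≤ n) :
    (b / a) ^ ((m * n + n) % 2) * u m * u (n - m + 1) +
      c * (b / a) ^ ((m * n) % 2) * u (m - 1) * u (n - m) = u n := by
  have hE : ∀ j, u (2 * j + 2) = a * u (2 * j + 1) + c * u (2 * j) := by
    intro j
    have h := hu (2 * j + 2) (by omega)
    rw [if_pos (by rw [Nat.even_iff]; omega)] at h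
    exact h
  have hO : ∀ j, u (2 * j + 3) = b * u (2 * j + 2) + c * u (2 * j + 1) := by
    intro j
    have h := hu (2 * j + 3) (by omega)
    rw [if_neg (by rw [Nat.even_iff]; omega)] at h
    exact h
  obtain ⟨r, hr⟩ : ∃ r, r = b / a := ⟨_, rfl⟩
  have hra : r * a = b := by rw [hr]; field_simp
  rw [← hr]
  have key : ∀ i j,
      u (2 * i + 1) * u (2 * j + 1) + c * r * u (2 * i) * u (2 * j) = u (2 * (i + j) + 1) ∧
      u (2 * i + 1) * u (2 * j + 2) + c * u (2 * i) * u (2 * j + 1) = u (2 * (i + j) + 2) := by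
    intro i j
    induction j with
    | zero =>
      have h := hE 0
      simp only [Nat.mul_zero, Nat.zero_add, Nat.add_zero, hu0, hu1] at h ⊢
      rw [hE i, h]
      constructor <;> ring
    | succ j ih =>
      obtain ⟨h1, h2⟩ := ih
      have e1 : u (2 * (i + (j + 1)) + 1) = b * u (2 * (i + j) + 2) + c * u (2 * (i + j) + 1) :=
        hO (i + j)
      have A : u (2 * i + 1) * u (2 * (j + 1) + 1) + c * r * u (2 * i) * u (2 * (j + 1))
          = u (2 * (i + (j + 1)) + 1) := by
        rw [e1, ← h1, ← h2]
        have e2 : u (2 * (j + 1) + 1) = b * u (2 * j + 2) + c * u (2 * j + 1) := hO j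
        have e3 : u (2 * (j + 1)) = u (2 * j + 2) := rfl
        rw [e2, e3, hE j, ← hra]
        ring
      refine ⟨A, ?_⟩
      rw [hE (i + (j + 1)), ← A]
      have e4 : u (2 * (i + (j + 1))) = u (2 * (i + j) + 2) := rfl
      have e3 : u (2 * (j + 1)) = u (2 * j + 2) := rfl
      rw [e4, ← h2, hE (j + 1)]
      have e2 : u (2 * (j + 1) + 1) = b * u (2 * j + 2) + c * u (2 * j + 1) := hO j
      rw [e3, e2, ← hra]
      ring
  obtain ⟨p, rfl⟩ : ∃ p, m = p + 1 := ⟨m - 1, by omega⟩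
  obtain ⟨k, rfl⟩ : ∃ k, n = p + 1 + k := ⟨n - (p + 1), by omega⟩
  have s1 : p + 1 + k - (p + 1) = k := by omega
  rw [s1, Nat.add_sub_cancel]
  rcases Nat.even_or_odd' p with ⟨i, rfl | rfl⟩ <;>
    rcases Nat.even_or_odd' k with ⟨j, rfl | rfl⟩
  · have x1 : ((2 * i + 1) * (2 * i + 1 + 2 * j) + (2 * i + 1 + 2 * j)) % 2 = 0 := by
      simp [Nat.add_mod, Nat.mul_mod]
    have x2 : ((2 * i + 1) * (2 * i + 1 + 2 * j)) % 2 = 1 := by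
      simp [Nat.add_mod, Nat.mul_mod]
    rw [x1, x2, show 2 * i + 1 + 2 * j = 2 * (i + j) + 1 by ring, ← (key i j).1]
    ring
  · have x1 : ((2 * i + 1) * (2 * i + 1 + (2 * j + 1)) + (2 * i + 1 + (2 * j + 1))) % 2 = 0 := by
      simp [Nat.add_mod, Nat.mul_mod]
    have x2 : ((2 * i + 1) * (2 * i + 1 + (2 * j + 1))) % 2 = 0 := by
      simp [Nat.add_mod, Nat.mul_mod]
    rw [x1, x2, show 2 * i + 1 + (2 * j + 1) = 2 * (i + j) + 2 by ring, ← (key i j).2]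
    ring
  · have x1 : ((2 * i + 1 + 1) * (2 * i + 1 + 1 + 2 * j) + (2 * i + 1 + 1 + 2 * j)) % 2 = 0 := by
      simp [Nat.add_mod, Nat.mul_mod]
    have x2 : ((2 * i + 1 + 1) * (2 * i + 1 + 1 + 2 * j)) % 2 = 0 := by
      simp [Nat.add_mod, Nat.mul_mod]
    rw [x1, x2, show 2 * i + 1 + 1 + 2 * j = 2 * (j + i) + 2 by ring, ← (key j i).2]
    ring
  · have x1 : ((2 * i + 1 + 1) * (2 * i + 1 + 1 + (2 * j + 1)) +
        (2 * i + 1 + 1 + (2 * j + 1))) % 2 = 1 := by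
      simp [Nat.add_mod, Nat.mul_mod]
    have x2 : ((2 * i + 1 + 1) * (2 * i + 1 + 1 + (2 * j + 1))) % 2 = 0 := by
      simp [Nat.add_mod, Nat.mul_mod]
    rw [x1, x2, show 2 * i + 1 + 1 + (2 * j + 1) = 2 * ((i + 1) + j) + 1 by ring,
      ← (key (i + 1) j).1]
    have e2 : u (2 * (i + 1) + 1) = b * u (2 * i + 2) + c * u (2 * i + 1) := hO i
    have e3 : u (2 * (i + 1)) = u (2 * i + 2) := rfl
    have e4 : u (2 * i + 1 + 1) = u (2 * i + 2) := rfl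
    have e5 : u (2 * j + 1 + 1) = u (2 * j + 2) := rfl
    rw [e2, e3, e4, e5, hE j, ← hra]
    ring
end

section
/- For every integer n ≥ 0, v_n² − (Δ/a²)·u_n² = 4·(b/a)^{ζ(n)}·(−c)^n. -/
theorem stmt_4 (a b c : ℝ) (ha : a ≠ 0) (hb : b ≠ 0) (hc : c ≠ 0)
    (u : ℕ → ℝ) (hu0 : u 0 = 0) (hu1 : u 1 = 1)
    (hu : ∀ n : ℕ, 2 ≤ n → u n = (if Even n then a else b) * u (n - 1) + c * u (n - 2))
    (v : ℕ → ℝ) (hv0 : v 0 = 2) (hv1 : v 1 = b)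
    (hv : ∀ n : ℕ, 2 ≤ n → v n = (if Even n then a else b) * v (n - 1) + c * v (n - 2))
    (hΔ : a ^ 2 * b ^ 2 + 4 * a * b * c ≠ 0)
    (n : ℕ) :
    v n ^ 2 - (a ^ 2 * b ^ 2 + 4 * a * b * c) / a ^ 2 * u n ^ 2 =
      4 * (b / a) ^ (n % 2) * (-c) ^ n := by
  have hD : ∃ D, D = (a ^ 2 * b ^ 2 + 4 * a * b * c) / a ^ 2 := ⟨_, rfl⟩
  obtain ⟨D, hD⟩ := hD
  obtain ⟨r, hr⟩ : ∃ r, r = b / a := ⟨_, rfl⟩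
  have hra : b = r * a := by rw [hr]; field_simp
  have hD' : D = b ^ 2 + 4 * r * c := by rw [hD, hr]; field_simp
  rw [← hD, ← hr]
  have ue (k : ℕ) : u (2 * k + 2) = a * u (2 * k + 1) + c * u (2 * k) := by
    have h := hu (2 * k + 2) (by omega)
    rw [if_pos ⟨k + 1, by ring⟩] at h
    exact h
  have ve (k : ℕ) : v (2 * k + 2) = a * v (2 * k + 1) + c * v (2 * k) := by
    have h := hv (2 * k + 2) (by omega)
    rw [if_pos ⟨k + 1, by ring⟩] at h
    exact h
  have uo (k : ℕ) : u (2 * k + 3) = b * u (2 * k + 2) + c * u (2 * k + 1) := by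
    have h := hu (2 * k + 3) (by omega)
    rw [if_neg (by rintro ⟨m, hm⟩; omega)] at h
    exact h
  have vo (k : ℕ) : v (2 * k + 3) = b * v (2 * k + 2) + c * v (2 * k + 1) := by
    have h := hv (2 * k + 3) (by omega)
    rw [if_neg (by rintro ⟨m, hm⟩; omega)] at h
    exact h
  have key (k : ℕ) : v (2 * k) ^ 2 - D * u (2 * k) ^ 2 = 4 * c ^ (2 * k) ∧
      v (2 * k) * v (2 * k + 1) - D * (u (2 * k) * u (2 * k + 1)) = 2 * b * c ^ (2 * k) ∧
      v (2 * k + 1) ^ 2 - D * u (2 * k + 1) ^ 2 = -4 * r * c * c ^ (2 * k) := by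
    induction k with
    | zero =>
      simp only [mul_zero, zero_add, hu0, hu1, hv0, hv1, hD']
      refine ⟨by ring, by ring, by ring⟩
    | succ k ih =>
      obtain ⟨h1, h2, h3⟩ := ih
      have q1 : v (2 * k + 2) ^ 2 - D * u (2 * k + 2) ^ 2 = 4 * c ^ (2 * k + 2) := by
        rw [ue, ve]
        linear_combination c ^ 2 * h1 + 2 * a * c * h2 + a ^ 2 * h3
          + 4 * a * c * c ^ (2 * k) * hra
      have q2 : v (2 * k + 2) * v (2 * k + 1) - D * (u (2 * k + 2) * u (2 * k + 1))
          = -2 * b * c * c ^ (2 * k) := by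
        rw [ue, ve]
        linear_combination c * h2 + a * h3 + 4 * c * c ^ (2 * k) * hra
      refine ⟨q1, ?_, ?_⟩
      · change v (2 * k + 2) * v (2 * k + 3) - D * (u (2 * k + 2) * u (2 * k + 3))
          = 2 * b * c ^ (2 * k + 2)
        rw [uo, vo]
        linear_combination b * q1 + c * q2
      · change v (2 * k + 3) ^ 2 - D * u (2 * k + 3) ^ 2 = -4 * r * c * c ^ (2 * k + 2)
        rw [uo, vo]
        linear_combination b ^ 2 * q1 + 2 * b * c * q2 + c ^ 2 * h3
  obtain ⟨k, rfl | rfl⟩ := n.even_or_odd'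
  · rw [(key k).1, Nat.mul_mod_right, (even_two_mul k).neg_pow]
    ring
  · rw [(key k).2.2, Nat.mul_add_mod, pow_succ (-c), (even_two_mul k).neg_pow]
    norm_num
    ring
end

section
/- For all integers m, n ≥ 0, v_m·v_n + (Δ/a²)·u_m·u_n = 2·(b/a)^{ζ(n)·ζ(m)}·v_{n+m}. -/
theorem two_step_aux (a b c : ℝ) (u : ℕ → ℝ)
    (hu : ∀ n : ℕ, 2 ≤ n → u n = (if Even n then a else b) * u (n - 1) + c * u (n - 2)) (n : ℕ) :
    u (n + 4) = (a * b + 2 * c) * u (n + 2) - c ^ 2 * u n := by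
  have h4 := hu (n + 4) (by omega)
  have h3 := hu (n + 3) (by omega)
  have h2 := hu (n + 2) (by omega)
  rcases Nat.even_or_odd n with h | h
  · have e4 : Even (n + 4) := by grind
    have e3 : ¬ Even (n + 3) := by grind
    have e2 : Even (n + 2) := by grind
    simp only [e4, e3, e2, if_true, if_false, Nat.reduceSubDiff, Nat.add_sub_cancel] at h4 h3 h2
    rw [h4, h3]
    linear_combination (-c) * h2
  · have e4 : ¬ Even (n + 4) := by grind
    have e3 : Even (n + 3) := by grind
    have e2 : ¬ Even (n + 2) := by grind
    simp only [e4, e3, e2, if_true, if_false, Nat.reduceSubDiff, Nat.add_sub_cancel] at h4 h3 h2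
    rw [h4, h3]
    linear_combination (-c) * h2

theorem four_induction_aux (P : ℕ → Prop) (h0 : P 0) (h1 : P 1) (h2 : P 2) (h3 : P 3)
    (h : ∀ n, P n → P (n + 2) → P (n + 4)) : ∀ n, P n
  | 0 => h0
  | 1 => h1
  | 2 => h2
  | 3 => h3
  | n + 4 => h n (four_induction_aux P h0 h1 h2 h3 h n) (four_induction_aux P h0 h1 h2 h3 h (n + 2))


theorem stmt_5 (a b c : ℝ) (ha : a ≠ 0) (hb : b ≠ 0) (hc : c ≠ 0)
    (u : ℕ → ℝ) (hu0 : u 0 = 0) (hu1 : u 1 = 1)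
    (hu : ∀ n : ℕ, 2 ≤ n → u n = (if Even n then a else b) * u (n - 1) + c * u (n - 2))
    (v : ℕ → ℝ) (hv0 : v 0 = 2) (hv1 : v 1 = b)
    (hv : ∀ n : ℕ, 2 ≤ n → v n = (if Even n then a else b) * v (n - 1) + c * v (n - 2))
    (hΔ : a ^ 2 * b ^ 2 + 4 * a * b * c ≠ 0)
    (m n : ℕ) :
    v m * v n + (a ^ 2 * b ^ 2 + 4 * a * b * c) / a ^ 2 * u m * u n =
      2 * (b / a) ^ (n % 2 * (m % 2)) * v (n + m) := by
  have su := two_step_aux a b c u hu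
  have sv := two_step_aux a b c v hv
  have u2 : u 2 = a := by have := hu 2 le_rfl; norm_num [hu0, hu1] at this; exact this
  have v2 : v 2 = a * b + 2 * c := by
    have := hv 2 le_rfl; norm_num [hv0, hv1] at this; linarith
  have n3 : ¬ Even 3 := by decide
  have u3 : u 3 = a * b + c := by
    have := hu 3 (by norm_num); norm_num [n3, u2, hu1] at this; linarith
  have v3 : v 3 = a * b ^ 2 + 3 * b * c := by
    have := hv 3 (by norm_num); norm_num [n3, v2, hv1] at this; linarith
  have v4 := sv 0
  have v5 := sv 1
  have v6 := sv 2
  norm_num [hv0, hv1, v2, v3] at v4 v5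
  norm_num [v4, v2] at v6
  revert m
  induction n using four_induction_aux
  case h n h h' =>
    intro m
    have e := h m
    have e' := h' m
    have k : n + 4 + m = (n + m) + 4 := by ring
    have k' : n + 2 + m = (n + m) + 2 := by ring
    have q : (n + 4) % 2 = n % 2 := by omega
    have q' : (n + 2) % 2 = n % 2 := by omega
    rw [k', q'] at e'
    rw [k, q, sv, sv, su]
    linear_combination (a * b + 2 * c) * e' - c ^ 2 * e
  all_goals
    intro m
    induction m using four_induction_aux
    case h m e e' =>
      have q : (m + 4) % 2 = m % 2 := by omega
      have q' : (m + 2) % 2 = m % 2 := by omega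
      rw [q', ← add_assoc] at e'
      rw [q, ← add_assoc, sv, sv, su]
      linear_combination (a * b + 2 * c) * e' - c ^ 2 * e
    all_goals
      norm_num [hu0, hu1, u2, u3, hv0, hv1, v2, v3, v4, v5, v6]
      try field_simp
      try ring
end

section
/- For all integers m, n ≥ 0, u_m·v_n + u_n·v_m = 2·(b/a)^{ζ(n)·ζ(m)}·u_{n+m}. -/
lemma zero_of_rec (p q : ℝ) (f : ℕ → ℝ) (h : ∀ n, f (n + 4) = p * f (n + 2) + q * f n)
    (h0 : f 0 = 0) (h1 : f 1 = 0) (h2 : f 2 = 0) (h3 : f 3 = 0) : ∀ n, f n = 0 := by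
  intro n
  induction n using Nat.strong_induction_on with
  | _ n ih =>
    match n, ih with
    | 0, _ => exact h0
    | 1, _ => exact h1
    | 2, _ => exact h2
    | 3, _ => exact h3
    | k + 4, ih => rw [h, ih (k + 2) (by omega), ih k (by omega)]; ring

lemma step_rec (a b c : ℝ) (u : ℕ → ℝ)
    (hu : ∀ n : ℕ, 2 ≤ n → u n = (if Even n then a else b) * u (n - 1) + c * u (n - 2)) (n : ℕ) :
    u (n + 4) = (a * b + 2 * c) * u (n + 2) + (-c ^ 2) * u n := by
  have e4 := hu (n + 4) (by omega)
  have e3 := hu (n + 3) (by omega)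
  have e2 := hu (n + 2) (by omega)
  simp only [show n + 4 - 1 = n + 3 by omega, show n + 4 - 2 = n + 2 by omega,
    show n + 3 - 1 = n + 2 by omega, show n + 3 - 2 = n + 1 by omega,
    show n + 2 - 1 = n + 1 by omega, show n + 2 - 2 = n by omega] at e4 e3 e2
  by_cases hn : Even n
  · have h4 : Even (n + 4) := by grind
    have h3 : ¬ Even (n + 3) := by grind
    have h2 : Even (n + 2) := by grind
    rw [if_pos h4] at e4
    rw [if_neg h3] at e3
    rw [if_pos h2] at e2
    linear_combination e4 + a * e3 - c * e2
  · have h4 : ¬ Even (n + 4) := by grind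
    have h3 : Even (n + 3) := by grind
    have h2 : ¬ Even (n + 2) := by grind
    rw [if_neg h4] at e4
    rw [if_pos h3] at e3
    rw [if_neg h2] at e2
    linear_combination e4 + b * e3 - c * e2

theorem stmt_6 (a b c : ℝ) (ha : a ≠ 0) (hb : b ≠ 0) (hc : c ≠ 0)
    (u : ℕ → ℝ) (hu0 : u 0 = 0) (hu1 : u 1 = 1)
    (hu : ∀ n : ℕ, 2 ≤ n → u n = (if Even n then a else b) * u (n - 1) + c * u (n - 2))
    (v : ℕ → ℝ) (hv0 : v 0 = 2) (hv1 : v 1 = b)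
    (hv : ∀ n : ℕ, 2 ≤ n → v n = (if Even n then a else b) * v (n - 1) + c * v (n - 2))
    (m n : ℕ) :
    u m * v n + u n * v m = 2 * (b / a) ^ (n % 2 * (m % 2)) * u (n + m) := by
  have su := step_rec a b c u hu
  have sv := step_rec a b c v hv
  have u2 : u 2 = a := by rw [hu 2 (by norm_num)]; simp [hu0, hu1]
  have u3 : u 3 = b * a + c := by
    rw [hu 3 (by norm_num), if_neg (by decide)]; simp [u2, hu1]
  have v2 : v 2 = a * b + 2 * c := by
    rw [hv 2 (by norm_num), if_pos (by decide)]; simp [hv0, hv1]; ring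
  have v3 : v 3 = b * (a * b + 2 * c) + c * b := by
    rw [hv 3 (by norm_num), if_neg (by decide)]; simp [v2, hv1]
  have u4 := su 0
  have u5 := su 1
  have u6 := su 2
  norm_num at u4 u5 u6
  rw [u2, hu0] at u4
  rw [u3, hu1] at u5
  rw [u4, u2] at u6
  have step : ∀ k n, u k * v (n + 4) + u (n + 4) * v k
        - 2 * (b / a) ^ ((n + 4) % 2 * (k % 2)) * u (n + 4 + k)
      = (a * b + 2 * c) * (u k * v (n + 2) + u (n + 2) * v k
        - 2 * (b / a) ^ ((n + 2) % 2 * (k % 2)) * u (n + 2 + k))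
      + (-c ^ 2) * (u k * v n + u n * v k - 2 * (b / a) ^ (n % 2 * (k % 2)) * u (n + k)) := by
    intro k n
    have h := su (n + k)
    rw [add_right_comm n 4, add_right_comm n 2, h, su n, sv n,
      show (n + 4) % 2 = n % 2 by omega, show (n + 2) % 2 = n % 2 by omega]
    ring
  have key : ∀ n m, u m * v n + u n * v m - 2 * (b / a) ^ (n % 2 * (m % 2)) * u (n + m) = 0 := by
    intro n
    refine zero_of_rec (a * b + 2 * c) (-c ^ 2) _ ?_ ?_ ?_ ?_ ?_
    · intro m
      have := su (n + m)
      rw [su m, sv m, ← add_assoc, ← add_assoc, this, show (m + 4) % 2 = m % 2 by omega,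
        show (m + 2) % 2 = m % 2 by omega]
      ring
    all_goals
      revert n
      refine zero_of_rec (a * b + 2 * c) (-c ^ 2) _ ?_ ?_ ?_ ?_ ?_
      · exact step _
      all_goals
        norm_num [hu0, hu1, u2, u3, hv0, hv1, v2, v3, u4, u5, u6]
        try field_simp
        try ring
  linarith [key n m]
end

section
/- For all integers n ≥ m ≥ 0, v_m·v_n − (Δ/a²)·u_m·u_n = 2·(−c)^m·(a/b)^{−ζ(n)·ζ(m)}·v_{n−m}. -/
theorem stmt_7 (a b c : ℝ) (ha : a ≠ 0) (hb : b ≠ 0) (hc : c ≠ 0)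
    (u : ℕ → ℝ) (hu0 : u 0 = 0) (hu1 : u 1 = 1)
    (hu : ∀ n : ℕ, 2 ≤ n → u n = (if Even n then a else b) * u (n - 1) + c * u (n - 2))
    (v : ℕ → ℝ) (hv0 : v 0 = 2) (hv1 : v 1 = b)
    (hv : ∀ n : ℕ, 2 ≤ n → v n = (if Even n then a else b) * v (n - 1) + c * v (n - 2))
    (hΔ : a ^ 2 * b ^ 2 + 4 * a * b * c ≠ 0)
    (m n : ℕ) (hmn : m ≤ n) :
    v m * v n - (a ^ 2 * b ^ 2 + 4 * a * b * c) / a ^ 2 * u m * u n =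
      2 * (-c) ^ m * (a / b) ^ (-((n % 2 * (m % 2) : ℕ) : ℤ)) * v (n - m) := by
  have ue : ∀ j, u (2*j+2) = a * u (2*j+1) + c * u (2*j) := fun j => by
    have h := hu (2*j+2) (by omega)
    rwa [if_pos (by grind)] at h
  have uo : ∀ j, u (2*j+3) = b * u (2*j+2) + c * u (2*j+1) := fun j => by
    have h := hu (2*j+3) (by omega)
    rwa [if_neg (by grind)] at h
  have ve : ∀ j, v (2*j+2) = a * v (2*j+1) + c * v (2*j) := fun j => by
    have h := hv (2*j+2) (by omega)
    rwa [if_pos (by grind)] at h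
  have vo : ∀ j, v (2*j+3) = b * v (2*j+2) + c * v (2*j+1) := fun j => by
    have h := hv (2*j+3) (by omega)
    rwa [if_neg (by grind)] at h
  have hD : (a ^ 2 * b ^ 2 + 4 * a * b * c) / a ^ 2 = b^2 + 4 * (b/a) * c := by
    field_simp
  rw [hD]
  set r := b / a with hr
  have hra : r * a = b := by rw [hr]; field_simp
  have hab : (a / b)⁻¹ = r := by rw [hr, inv_div]
  generalize hDD : b^2 + 4 * r * c = D
  have base : ∀ j, v (2*j) * v (2*j) - D * u (2*j) * u (2*j) = 4 * c^(2*j) ∧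
      v (2*j) * v (2*j+1) - D * u (2*j) * u (2*j+1) = 2 * c^(2*j) * b ∧
      v (2*j+1) * v (2*j+1) - D * u (2*j+1) * u (2*j+1) = -4 * r * c^(2*j+1) := by
    intro j
    induction j with
    | zero =>
      simp only [Nat.mul_zero, Nat.zero_add, hu0, hu1, hv0, hv1, ← hDD]
      refine ⟨by ring, by ring, by ring⟩
    | succ j ih =>
      obtain ⟨h1, h2, h3⟩ := ih
      have e1 : 2 * (j+1) = 2*j+2 := by ring
      rw [e1, show 2*j+2+1 = 2*j+3 from rfl]
      have k1 : v (2*j+2) * v (2*j+2) - D * u (2*j+2) * u (2*j+2) = 4 * c^(2*j+2) := by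
        rw [ve, ue, ← hra] at *
        linear_combination a^2*h3 + 2*a*c*h2 + c^2*h1
      have k0 : v (2*j+1) * v (2*j+2) - D * u (2*j+1) * u (2*j+2) = -2 * b * c^(2*j+1) := by
        rw [ve, ue]
        linear_combination a*h3 + c*h2 - 4 * c^(2*j+1) * hra
      have k2 : v (2*j+2) * v (2*j+3) - D * u (2*j+2) * u (2*j+3) = 2 * c^(2*j+2) * b := by
        rw [vo, uo]
        linear_combination b*k1 + c*k0
      refine ⟨k1, k2, ?_⟩
      rw [vo, uo]
      rw [← hra] at *
      linear_combination (r*a)^2*k1 + 2*(r*a)*c*k0 + c^2*h3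
  have key0 : ∀ j i, v (2*j) * v (2*j+2*i) - D * u (2*j) * u (2*j+2*i) = 2 * c^(2*j) * v (2*i) ∧
      v (2*j) * v (2*j+2*i+1) - D * u (2*j) * u (2*j+2*i+1) = 2 * c^(2*j) * v (2*i+1) := by
    intro j i
    obtain ⟨h1, h2, h3⟩ := base j
    induction i with
    | zero =>
      simp only [Nat.mul_zero, Nat.zero_add, Nat.add_zero, hv0, hv1]
      exact ⟨by linear_combination h1, h2⟩
    | succ i ih =>
      obtain ⟨g1, g2⟩ := ih
      have E1 := ve (j+i)
      have E2 := ue (j+i)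
      have E3 := vo (j+i)
      have E4 := uo (j+i)
      rw [show 2*(j+i) = 2*j+2*i by ring] at E1 E2 E3 E4
      rw [show 2*j+2*(i+1) = 2*j+2*i+2 by ring, show 2*(i+1) = 2*i+2 by ring,
        show 2*j+2*i+2+1 = 2*j+2*i+3 from rfl, show 2*i+2+1 = 2*i+3 from rfl]
      have q : v (2*j) * v (2*j+2*i+2) - D * u (2*j) * u (2*j+2*i+2) = 2 * c^(2*j) * v (2*i+2) := by
        rw [E1, E2, ve]
        linear_combination a*g2 + c*g1
      refine ⟨q, ?_⟩
      rw [E3, E4, vo]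
      linear_combination b*q + c*g2
  have key1 : ∀ j i, v (2*j+1) * v (2*j+2*i+1) - D * u (2*j+1) * u (2*j+2*i+1)
        = -2 * r * c^(2*j+1) * v (2*i) ∧
      v (2*j+1) * v (2*j+2*i+2) - D * u (2*j+1) * u (2*j+2*i+2)
        = -2 * c^(2*j+1) * v (2*i+1) := by
    intro j i
    obtain ⟨h1, h2, h3⟩ := base j
    induction i with
    | zero =>
      simp only [Nat.mul_zero, Nat.zero_add, Nat.add_zero, hv0, hv1]
      refine ⟨by linear_combination h3, ?_⟩
      rw [ve, ue]
      linear_combination a*h3 + c*h2 - 4 * c^(2*j+1) * hra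
    | succ i ih =>
      obtain ⟨g1, g2⟩ := ih
      have E3 := vo (j+i)
      have E4 := uo (j+i)
      have E1 := ve (j+i+1)
      have E2 := ue (j+i+1)
      rw [show 2*(j+i+1) = 2*j+2*i+2 by ring] at E1 E2
      rw [show 2*(j+i) = 2*j+2*i by ring] at E3 E4
      rw [show 2*j+2*(i+1) = 2*j+2*i+2 by ring, show 2*(i+1) = 2*i+2 by ring,
        show 2*i+2+1 = 2*i+3 from rfl]
      have q : v (2*j+1) * v (2*j+2*i+2+1) - D * u (2*j+1) * u (2*j+2*i+2+1)
          = -2 * r * c^(2*j+1) * v (2*i+2) := by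
        rw [show 2*j+2*i+2+1 = 2*j+2*i+3 from rfl, E3, E4, ve]
        linear_combination b*g2 + c*g1 + 2 * c^(2*j+1) * v (2*i+1) * hra
      refine ⟨q, ?_⟩
      rw [E1, E2, vo]
      linear_combination a*q + c*g2 - 2 * c^(2*j+1) * v (2*i+2) * hra
  obtain ⟨k, rfl⟩ := Nat.exists_eq_add_of_le hmn
  rw [Nat.add_sub_cancel_left]
  obtain ⟨j, rfl | rfl⟩ := Nat.even_or_odd' m <;> obtain ⟨i, rfl | rfl⟩ := Nat.even_or_odd' k
  · rw [show (2*j+2*i) % 2 * (2*j % 2) = 0 by simp, (key0 j i).1, pow_mul, pow_mul]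
    simp
  · rw [show (2*j+(2*i+1)) % 2 * (2*j % 2) = 0 by simp, ← add_assoc, (key0 j i).2, pow_mul, pow_mul]
    simp
  · rw [show (2*j+1+2*i) % 2 * ((2*j+1) % 2) = 1 by
        rw [show (2*j+1+2*i) % 2 = 1 by omega, show (2*j+1) % 2 = 1 by omega],
      show 2*j+1+2*i = 2*j+2*i+1 by ring, (key1 j i).1, Nat.cast_one, zpow_neg_one, hab,
      Odd.neg_pow ⟨j, rfl⟩]
    ring
  · rw [show (2*j+1+(2*i+1)) % 2 * ((2*j+1) % 2) = 0 by
        rw [show (2*j+1+(2*i+1)) % 2 = 0 by omega, zero_mul],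
      show 2*j+1+(2*i+1) = 2*j+2*i+2 by ring, (key1 j i).2, Odd.neg_pow ⟨j, rfl⟩]
    simp
end

section
/- For all integers n ≥ m ≥ 0, u_n·v_m − u_m·v_n = 2·(−c)^m·(a/b)^{−ζ(n)·ζ(m)}·u_{n−m}. -/
theorem stmt_8 (a b c : ℝ) (ha : a ≠ 0) (hb : b ≠ 0) (hc : c ≠ 0)
    (u : ℕ → ℝ) (hu0 : u 0 = 0) (hu1 : u 1 = 1)
    (hu : ∀ n : ℕ, 2 ≤ n → u n = (if Even n then a else b) * u (n - 1) + c * u (n - 2))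
    (v : ℕ → ℝ) (hv0 : v 0 = 2) (hv1 : v 1 = b)
    (hv : ∀ n : ℕ, 2 ≤ n → v n = (if Even n then a else b) * v (n - 1) + c * v (n - 2))
    (m n : ℕ) (hmn : m ≤ n) :
    u n * v m - u m * v n =
      2 * (-c) ^ m * (a / b) ^ (-((n % 2 * (m % 2) : ℕ) : ℤ)) * u (n - m) := by
  have hu' : ∀ k : ℕ, u (k + 2) = (if Even k then a else b) * u (k + 1) + c * u k := by
    intro k
    have h := hu (k + 2) (by omega)
    simpa [Nat.even_add] using h
  have hv' : ∀ k : ℕ, v (k + 2) = (if Even k then a else b) * v (k + 1) + c * v k := by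
    intro k
    have h := hv (k + 2) (by omega)
    simpa [Nat.even_add] using h
  have hD : ∀ m : ℕ, u (m + 1) * v m - u m * v (m + 1) = 2 * (-c) ^ m := by
    intro m
    induction m with
    | zero => simp [hu0, hu1, hv0]
    | succ k ih =>
      rw [hu' k, hv' k, pow_succ]
      linear_combination (-c) * ih
  have key : ∀ k : ℕ,
      (u (m + k) * v m - u m * v (m + k) =
        2 * (-c) ^ m * (if Even m then 1 else if Even k then b / a else 1) * u k) ∧
      (u (m + (k + 1)) * v m - u m * v (m + (k + 1)) =
        2 * (-c) ^ m * (if Even m then 1 else if Even (k + 1) then b / a else 1) * u (k + 1)) := by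
    intro k
    induction k with
    | zero =>
      refine ⟨by simp [hu0], ?_⟩
      have := hD m
      simp [hu1, this]
    | succ k ih =>
      refine ⟨ih.2, ?_⟩
      obtain ⟨h1, h2⟩ := ih
      have e1 := hu' (m + k)
      have e2 := hv' (m + k)
      have e3 := hu' k
      have e : m + (k + 1 + 1) = m + k + 2 := by ring
      have e' : m + (k + 1) = m + k + 1 := by ring
      have e'' : k + 1 + 1 = k + 2 := rfl
      rw [e'] at h2
      rw [e, e'', e1, e2, e3]
      by_cases hm : Even m <;> by_cases hk : Even k <;>
        simp only [Nat.even_add, Nat.even_add_one, hm, hk, if_true, if_false, not_true,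
          not_false_iff, iff_true, iff_false, iff_self] at h1 h2 ⊢
      · linear_combination a * h2 + c * h1
      · linear_combination b * h2 + c * h1
      · have hab : b / a * a = b := div_mul_cancel₀ b ha
        linear_combination b * h2 + c * h1 - 2 * (-c) ^ m * u (k + 1) * hab
      · have hab : b / a * a = b := div_mul_cancel₀ b ha
        linear_combination a * h2 + c * h1 + 2 * (-c) ^ m * u (k + 1) * hab
  obtain ⟨k, rfl⟩ := Nat.exists_eq_add_of_le hmn
  rw [(key k).1, Nat.add_sub_cancel_left]
  congr 2
  rcases Nat.mod_two_eq_zero_or_one m with hm | hm <;>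
    rcases Nat.mod_two_eq_zero_or_one k with hk | hk <;>
    simp [Nat.even_iff, Nat.add_mod, hm, hk]
end

section
/- For all integers n ≥ m ≥ 0, v_{n+m} + (−c)^m·v_{n−m} = (a/b)^{ζ(n)·ζ(m)}·v_m·v_n. -/
theorem stmt_9 (a b c : ℝ) (ha : a ≠ 0) (hb : b ≠ 0) (hc : c ≠ 0)
    (v : ℕ → ℝ) (hv0 : v 0 = 2) (hv1 : v 1 = b)
    (hv : ∀ n : ℕ, 2 ≤ n → v n = (if Even n then a else b) * v (n - 1) + c * v (n - 2))
    (m n : ℕ) (hmn : m ≤ n) :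
    v (n + m) + (-c) ^ m * v (n - m) = (a / b) ^ (n % 2 * (m % 2)) * v m * v n := by
  have he : ∀ k : ℕ, k % 2 = 0 → v (k + 2) = a * v (k + 1) + c * v k := by
    intro k hk
    have h := hv (k + 2) (by omega)
    rw [if_pos (Nat.even_iff.2 (by omega))] at h
    exact h
  have ho : ∀ k : ℕ, k % 2 = 1 → v (k + 2) = b * v (k + 1) + c * v k := by
    intro k hk
    have h := hv (k + 2) (by omega)
    rw [if_neg (by rw [Nat.even_iff]; omega)] at h
    exact h
  induction m using Nat.strong_induction_on with
  | _ m ih =>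
    match m, ih, hmn with
    | 0, _, _ => simp [hv0]; ring
    | 1, _, hmn =>
      obtain ⟨k, rfl⟩ := Nat.exists_eq_add_of_le' hmn
      rw [show k + 1 - 1 = k by omega, show k + 1 + 1 = k + 2 by omega]
      rcases Nat.mod_two_eq_zero_or_one k with hk | hk
      · rw [he k hk, show (k + 1) % 2 = 1 by omega, hv1]
        have hab : a / b * b = a := by field_simp
        simp only [Nat.one_mod, mul_one, pow_one]
        linear_combination - v (k + 1) * hab
      · rw [ho k hk, show (k + 1) % 2 = 0 by omega, hv1]
        norm_num
    | m + 2, ih, hmn =>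
      obtain ⟨k, rfl⟩ := Nat.exists_eq_add_of_le' hmn
      have h0 := ih m (by omega) (by omega)
      have h1 := ih (m + 1) (by omega) (by omega)
      rw [show k + (m + 2) - m = k + 2 by omega] at h0
      rw [show k + (m + 2) - (m + 1) = k + 1 by omega,
        show k + (m + 2) + (m + 1) = k + (m + 2) + m + 1 by omega] at h1
      rw [show k + (m + 2) - (m + 2) = k by omega,
        show k + (m + 2) + (m + 2) = k + (m + 2) + m + 2 by omega]
      generalize hn : k + (m + 2) = n at *
      rcases Nat.mod_two_eq_zero_or_one k with hk | hk <;>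
      rcases Nat.mod_two_eq_zero_or_one m with hm | hm
      · rw [he k hk, show n % 2 = 0 by omega] at h0
        rw [show n % 2 = 0 by omega] at h1
        rw [he (n + m) (by omega), show n % 2 = 0 by omega, he m hm]
        simp only [zero_mul, pow_zero, one_mul] at *
        linear_combination a * h1 + c * h0
      · rw [he k hk, show n % 2 = 1 by omega, hm] at h0
        rw [show n % 2 = 1 by omega, show (m + 1) % 2 = 0 by omega] at h1
        rw [he (n + m) (by omega), show n % 2 = 1 by omega, show (m + 2) % 2 = 1 by omega, ho m hm]
        simp only [mul_zero, mul_one, pow_zero, pow_one, one_mul] at *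
        have hab : a / b * b = a := by field_simp
        linear_combination a * h1 + c * h0 - v (m + 1) * v n * hab
      · rw [ho k hk, show n % 2 = 1 by omega, hm] at h0
        rw [show n % 2 = 1 by omega, show (m + 1) % 2 = 1 by omega] at h1
        rw [ho (n + m) (by omega), show n % 2 = 1 by omega, show (m + 2) % 2 = 0 by omega, he m hm]
        simp only [mul_zero, mul_one, pow_zero, pow_one, one_mul] at *
        have hab : a / b * b = a := by field_simp
        linear_combination b * h1 + c * h0 + v (m + 1) * v n * hab
      · rw [ho k hk, show n % 2 = 0 by omega] at h0
        rw [show n % 2 = 0 by omega] at h1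
        rw [ho (n + m) (by omega), show n % 2 = 0 by omega, ho m hm]
        simp only [zero_mul, pow_zero, one_mul] at *
        linear_combination b * h1 + c * h0
end

section
/- For all integers n ≥ m ≥ 0, u_{n+m} + (−c)^m·u_{n−m} = (a/b)^{ζ(n)·ζ(m)}·u_n·v_m. -/
theorem stmt_10 (a b c : ℝ) (ha : a ≠ 0) (hb : b ≠ 0) (hc : c ≠ 0)
    (u : ℕ → ℝ) (hu0 : u 0 = 0) (hu1 : u 1 = 1)
    (hu : ∀ n : ℕ, 2 ≤ n → u n = (if Even n then a else b) * u (n - 1) + c * u (n - 2))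
    (v : ℕ → ℝ) (hv0 : v 0 = 2) (hv1 : v 1 = b)
    (hv : ∀ n : ℕ, 2 ≤ n → v n = (if Even n then a else b) * v (n - 1) + c * v (n - 2))
    (m n : ℕ) (hmn : m ≤ n) :
    u (n + m) + (-c) ^ m * u (n - m) = (a / b) ^ (n % 2 * (m % 2)) * u n * v m := by
  have key : ∀ w : ℕ → ℝ, (∀ n : ℕ, 2 ≤ n →
      w n = (if Even n then a else b) * w (n - 1) + c * w (n - 2)) →
      (∀ k, k % 2 = 0 → w (k + 2) = a * w (k + 1) + c * w k) ∧
      (∀ k, k % 2 = 1 → w (k + 2) = b * w (k + 1) + c * w k) := by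
    intro w hw
    constructor
    · intro k hk
      have h := hw (k + 2) (by omega)
      rw [if_pos (Nat.even_iff.2 (by omega))] at h
      exact h
    · intro k hk
      have h := hw (k + 2) (by omega)
      rw [if_neg (by rw [Nat.even_iff]; omega)] at h
      exact h
  have four : ∀ w : ℕ → ℝ, (∀ n : ℕ, 2 ≤ n →
      w n = (if Even n then a else b) * w (n - 1) + c * w (n - 2)) →
      ∀ k, w (k + 4) = (a * b + 2 * c) * w (k + 2) - c ^ 2 * w k := by
    intro w hw k
    obtain ⟨h0, h1⟩ := key w hw
    rcases Nat.mod_two_eq_zero_or_one k with hk | hk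
    · have e1 := h0 k hk
      have e2 := h1 (k + 1) (by omega)
      have e3 := h0 (k + 2) (by omega)
      simp only [add_assoc, Nat.reduceAdd] at e1 e2 e3
      rw [e3, e2]; linear_combination (-c) * e1
    · have e1 := h1 k hk
      have e2 := h0 (k + 1) (by omega)
      have e3 := h1 (k + 2) (by omega)
      simp only [add_assoc, Nat.reduceAdd] at e1 e2 e3
      rw [e3, e2]; linear_combination (-c) * e1
  obtain ⟨u0, u1⟩ := key u hu
  obtain ⟨v0, v1⟩ := key v hv
  have hv2 : v 2 = a * b + 2 * c := by rw [v0 0 rfl, hv0]; simp only [zero_add, hv1]; ring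
  have hv3 : v 3 = b * (a * b + 3 * c) := by
    rw [v1 1 rfl]; simp only [Nat.reduceAdd, hv1, hv2]; ring
  have u4 := four u hu
  have v4 := four v hv
  have main : ∀ m k, u (k + m + m) + (-c) ^ m * u k
      = (a / b) ^ ((k + m) % 2 * (m % 2)) * u (k + m) * v m := by
    intro m
    induction m using Nat.strong_induction_on with
    | _ m ih =>
    intro k
    match m, ih with
    | 0, _ => simp [hv0]; ring
    | 1, _ =>
      rcases Nat.mod_two_eq_zero_or_one k with hk | hk
      · have : (k + 1) % 2 = 1 := by omega
        rw [this, hv1]; simp only [add_assoc, Nat.reduceAdd, u0 k hk]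
        norm_num; field_simp
      · have : (k + 1) % 2 = 0 := by omega
        rw [this, hv1]; simp only [add_assoc, Nat.reduceAdd, u1 k hk]
        norm_num; ring
    | 2, _ =>
      simp only [add_assoc, Nat.reduceAdd, u4 k, hv2]
      norm_num; ring
    | 3, _ =>
      have e6 := u4 (k + 2)
      have e4 := u4 k
      simp only [add_assoc, Nat.reduceAdd] at e6 e4 ⊢
      rw [hv3, e6, e4]
      rcases Nat.mod_two_eq_zero_or_one k with hk | hk
      · have : (k + 3) % 2 = 1 := by omega
        have e3 := u1 (k + 1) (by omega)
        simp only [add_assoc, Nat.reduceAdd] at e3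
        rw [this, e3, u0 k hk]
        norm_num
        field_simp; ring
      · have : (k + 3) % 2 = 0 := by omega
        have e3 := u0 (k + 1) (by omega)
        simp only [add_assoc, Nat.reduceAdd] at e3
        rw [this, e3, u1 k hk]
        norm_num; ring
    | m + 4, ih =>
      have i2 := ih (m + 2) (by omega) (k + 2)
      have i0 := ih m (by omega) (k + 4)
      have p2 : (k + 2 + (m + 2)) % 2 = (k + (m + 4)) % 2 := by omega
      have p0 : (k + 4 + m) % 2 = (k + (m + 4)) % 2 := by omega
      have q2 : (m + 2) % 2 = (m + 4) % 2 := by omega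
      have q0 : m % 2 = (m + 4) % 2 := by omega
      rw [p2, q2] at i2
      rw [p0, q0] at i0
      rw [show k + 2 + (m + 2) = k + (m + 4) by omega] at i2
      rw [show k + 4 + m = k + (m + 4) by omega] at i0
      have s := u4 (k + (m + 4) + m)
      have t := u4 k
      rw [v4 m]
      rw [show k + (m + 4) + (m + 4) = k + (m + 4) + m + 4 by omega, s]
      rw [show k + (m + 4) + (m + 2) = k + (m + 4) + m + 2 by omega] at i2
      linear_combination (a * b + 2 * c) * i2 - c ^ 2 * i0 + (-c) ^ m * c ^ 2 * t
  obtain ⟨k, rfl⟩ := Nat.exists_eq_add_of_le' hmn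
  rw [Nat.add_sub_cancel]
  exact main m k
end

section
/- For all nonnegative integers n, r and every integer m > 1, u_{mn+r} = (a^{1−ζ(mn+r)} / (ab)^{⌊(mn+r)/2⌋}) · Σ_{i=0}^{n} C(n,i)·c^{n−i}·u_m^{i}·u_{m−1}^{n−i}·u_{i+r}·δ[m,n,r,i], where δ[m,n,r,i] := (ab)^{⌊(i+r)/2⌋ + n·⌊m/2⌋} · a^{−ζ(m+1)·i − 1 + ζ(i+r)} · b^{ζ(m)·(n−i)}, powers with possibly negative integer exponents being taken in the sense of integer powers of nonzero real numbers. -/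
theorem aux_binom (A B : ℝ) (v : ℕ → ℝ) (m : ℕ)
    (h : ∀ k, v (m + k) = A * v (k + 1) + B * v k) (n : ℕ) : ∀ r,
    v (m * n + r) = ∑ i ∈ Finset.range (n + 1),
      (n.choose i : ℝ) * (A ^ i * B ^ (n - i) * v (i + r)) := by
  have key : ∀ r, v (m * n + r) = ∑ ij ∈ Finset.HasAntidiagonal.antidiagonal n,
      (n.choose ij.1 : ℝ) * (A ^ ij.1 * B ^ ij.2 * v (ij.1 + r)) := by
    induction n with
    | zero => intro r; simp
    | succ n ih =>
      intro r
      have e := Finset.sum_antidiagonal_choose_succ_mul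
        (fun i j => A ^ i * B ^ j * v (i + r)) n
      rw [e]
      have e2 : m * (n + 1) + r = m + (m * n + r) := by ring
      rw [e2, h, add_assoc (m * n) r 1, ih, ih, add_comm, Finset.mul_sum, Finset.mul_sum]
      congr 1
      · apply Finset.sum_congr rfl
        intro x _
        ring
      · apply Finset.sum_congr rfl
        intro x hx
        have hx' := Finset.HasAntidiagonal.mem_antidiagonal.1 hx
        have : n.choose x.2 = n.choose x.1 := by
          rw [← hx']; exact (Nat.choose_symm_add).symm
        rw [this, show x.1 + (r + 1) = x.1 + 1 + r by ring]
        ring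
  intro r
  rw [key r, Finset.Nat.sum_antidiagonal_eq_sum_range_succ
    (fun i j => (n.choose i : ℝ) * (A ^ i * B ^ j * v (i + r)))]

theorem aux_add (p q : ℝ) (v : ℕ → ℝ) (h0 : v 0 = 0) (h1 : v 1 = 1)
    (h : ∀ k, v (k + 2) = p * v (k + 1) + q * v k) (m : ℕ) : ∀ k,
    v (m + 1 + k) = v (m + 1) * v (k + 1) + q * v m * v k := by
  induction m with
  | zero => intro k; simp [h0, h1, add_comm]
  | succ m ih =>
    intro k
    rw [show m + 1 + 1 + k = m + 1 + (k + 1) by ring, ih, h k, h m]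
    ring

theorem stmt_13 (a b c : ℝ) (ha : a ≠ 0) (hb : b ≠ 0) (hc : c ≠ 0)
    (u : ℕ → ℝ) (hu0 : u 0 = 0) (hu1 : u 1 = 1)
    (hu : ∀ n : ℕ, 2 ≤ n → u n = (if Even n then a else b) * u (n - 1) + c * u (n - 2))
    (m n r : ℕ) (hm : 1 < m) :
    u (m * n + r) =
      a ^ (1 - (m * n + r) % 2) / (a * b) ^ ((m * n + r) / 2) *
        ∑ i ∈ Finset.range (n + 1),
          (n.choose i : ℝ) * c ^ (n - i) * u m ^ i * u (m - 1) ^ (n - i) * u (i + r) *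
            ((a * b) ^ ((i + r) / 2 + n * (m / 2)) *
              a ^ (-(((m + 1) % 2 : ℕ) : ℤ) * (i : ℤ) - 1 + (((i + r) % 2 : ℕ) : ℤ)) *
              b ^ (m % 2 * (n - i))) := by
  have hab : a * b ≠ 0 := mul_ne_zero ha hb
  obtain ⟨v, hv⟩ : ∃ v : ℕ → ℝ, ∀ k, v k =
      u k * (a * b) ^ (k / 2) * a ^ (((k % 2 : ℕ) : ℤ) - 1) := ⟨_, fun _ => rfl⟩
  have he : ∀ t, v (2 * t) = u (2 * t) * (a * b) ^ t * a⁻¹ := by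
    intro t
    rw [hv, show 2 * t / 2 = t by omega, show 2 * t % 2 = 0 by omega]
    simp
  have ho : ∀ t, v (2 * t + 1) = u (2 * t + 1) * (a * b) ^ t := by
    intro t
    rw [hv, show (2 * t + 1) / 2 = t by omega, show (2 * t + 1) % 2 = 1 by omega]
    simp
  have h0 : v 0 = 0 := by rw [hv, hu0]; simp
  have h1 : v 1 = 1 := by rw [hv, hu1]; simp
  have hrec : ∀ k, v (k + 2) = (a * b) * v (k + 1) + (a * b * c) * v k := by
    intro k
    have hk := hu (k + 2) (by omega)
    rw [show k + 2 - 1 = k + 1 by omega, show k + 2 - 2 = k by omega] at hk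
    rcases Nat.even_or_odd' k with ⟨t, rfl | rfl⟩
    · rw [if_pos ⟨t + 1, by ring⟩] at hk
      rw [ho, he, show 2 * t + 2 = 2 * (t + 1) by ring, he,
        show 2 * (t + 1) = 2 * t + 2 by ring, hk]
      field_simp
      ring
    · rw [if_neg (by rw [Nat.even_iff]; omega)] at hk
      rw [ho, show 2 * t + 1 + 2 = 2 * (t + 1) + 1 by ring, ho,
        show 2 * t + 1 + 1 = 2 * (t + 1) by ring, he,
        show 2 * (t + 1) + 1 = 2 * t + 1 + 2 by ring, hk,
        show 2 * t + 1 + 1 = 2 * (t + 1) by ring]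
      field_simp
      try ring
  have hadd : ∀ k, v (m + k) = v m * v (k + 1) + (a * b * c * v (m - 1)) * v k := by
    intro k
    have := aux_add _ _ v h0 h1 hrec (m - 1) k
    rwa [show m - 1 + 1 = m by omega] at this
  have hA : v m = u m * (a * b) ^ (m / 2) * a ^ (-(((m + 1) % 2 : ℕ) : ℤ)) := by
    rw [hv]
    congr 2
    omega
  have hB : a * b * c * v (m - 1) = c * u (m - 1) * (a * b) ^ (m / 2) * b ^ (m % 2) := by
    rcases Nat.even_or_odd' m with ⟨t, rfl | rfl⟩
    · obtain ⟨s, rfl⟩ : ∃ s, t = s + 1 := ⟨t - 1, by omega⟩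
      rw [show 2 * (s + 1) - 1 = 2 * s + 1 by omega, ho,
        show 2 * (s + 1) / 2 = s + 1 by omega, show 2 * (s + 1) % 2 = 0 by omega]
      ring
    · rw [show 2 * t + 1 - 1 = 2 * t by omega, he,
        show (2 * t + 1) / 2 = t by omega, show (2 * t + 1) % 2 = 1 by omega]
      field_simp
  have main := aux_binom _ _ v m hadd n r
  have hinv : ∀ k, u k = a ^ (1 - k % 2) / (a * b) ^ (k / 2) * v k := by
    intro k
    have hz : a ^ (((k % 2 : ℕ) : ℤ) - 1) * a ^ (1 - k % 2) = 1 := by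
      rw [← zpow_natCast, ← zpow_add₀ ha]
      rw [show ((k % 2 : ℕ) : ℤ) - 1 + ((1 - k % 2 : ℕ) : ℤ) = 0 by omega, zpow_zero]
    have hp : (a * b) ^ (k / 2) ≠ 0 := pow_ne_zero _ hab
    rw [hv, div_mul_eq_mul_div, eq_div_iff hp]
    linear_combination (-(u k * (a * b) ^ (k / 2))) * hz
  rw [hinv (m * n + r), main]
  congr 1
  apply Finset.sum_congr rfl
  intro i hi
  have hin : i ≤ n := by have := Finset.mem_range.1 hi; omega
  rw [hA, hB, hv (i + r)]
  have e1 : a ^ (-(((m + 1) % 2 : ℕ) : ℤ) * (i : ℤ) - 1 + (((i + r) % 2 : ℕ) : ℤ))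
      = (a ^ (-(((m + 1) % 2 : ℕ) : ℤ))) ^ i * a ^ ((((i + r) % 2 : ℕ) : ℤ) - 1) := by
    rw [← zpow_natCast, ← zpow_mul, ← zpow_add₀ ha]
    congr 1
    ring
  have e2 : (a * b) ^ ((i + r) / 2 + n * (m / 2))
      = (a * b) ^ ((i + r) / 2) * (((a * b) ^ (m / 2)) ^ i * ((a * b) ^ (m / 2)) ^ (n - i)) := by
    rw [← pow_add ((a * b) ^ (m / 2)), Nat.add_sub_cancel' hin, ← pow_mul, ← pow_add,
      mul_comm n]
  rw [e1, e2, pow_mul b]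
  generalize a ^ (-(((m + 1) % 2 : ℕ) : ℤ)) = X
  generalize a ^ ((((i + r) % 2 : ℕ) : ℤ) - 1) = Y
  generalize (a * b) ^ (m / 2) = Z
  generalize (a * b) ^ ((i + r) / 2) = W
  generalize b ^ (m % 2) = V
  simp only [mul_pow]
  ring
end

section
/- For all positive integers n and p, w_{n+p} = (b/a)^{ζ(n+1)·ζ(p)}·u_n·w_{p+1} + c·(b/a)^{ζ(n)·ζ(p+1)}·u_{n−1}·w_p. -/
theorem stmt_15 (a b c : ℝ) (ha : a ≠ 0) (hb : b ≠ 0) (hc : c ≠ 0)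
    (u : ℕ → ℝ) (hu0 : u 0 = 0) (hu1 : u 1 = 1)
    (hu : ∀ n : ℕ, 2 ≤ n → u n = (if Even n then a else b) * u (n - 1) + c * u (n - 2))
    (w : ℕ → ℝ)
    (hw : ∀ n : ℕ, 2 ≤ n → w n = (if Even n then a else b) * w (n - 1) + c * w (n - 2))
    (n p : ℕ) (hn : 1 ≤ n) (hp : 1 ≤ p) :
    w (n + p) = (b / a) ^ ((n + 1) % 2 * (p % 2)) * u n * w (p + 1) +
      c * (b / a) ^ (n % 2 * ((p + 1) % 2)) * u (n - 1) * w p := by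
  have ue : ∀ k, u (2 * k + 2) = a * u (2 * k + 1) + c * u (2 * k) := by
    intro k
    have h := hu (2 * k + 2) (by omega)
    rw [if_pos (by rw [Nat.even_iff]; omega)] at h
    exact h
  have uo : ∀ k, u (2 * k + 3) = b * u (2 * k + 2) + c * u (2 * k + 1) := by
    intro k
    have h := hu (2 * k + 3) (by omega)
    rw [if_neg (by rw [Nat.even_iff]; omega)] at h
    exact h
  have we : ∀ m, m % 2 = 0 → w (m + 2) = a * w (m + 1) + c * w m := by
    intro m hm
    have h := hw (m + 2) (by omega)
    rw [if_pos (by rw [Nat.even_iff]; omega)] at h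
    exact h
  have wo : ∀ m, m % 2 = 1 → w (m + 2) = b * w (m + 1) + c * w m := by
    intro m hm
    have h := hw (m + 2) (by omega)
    rw [if_neg (by rw [Nat.even_iff]; omega)] at h
    exact h
  have u2 : u 2 = a := by have := ue 0; simpa [hu0, hu1] using this
  obtain ⟨k, hk⟩ : ∃ k, n = 2 * k + 1 ∨ n = 2 * k + 2 := ⟨(n - 1) / 2, by omega⟩
  rcases Nat.mod_two_eq_zero_or_one p with h0 | h1
  · have key : ∀ k, w (p + 2 * k + 1) = u (2 * k + 1) * w (p + 1) + c * (b / a) * u (2 * k) * w p ∧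
        w (p + 2 * k + 2) = u (2 * k + 2) * w (p + 1) + c * u (2 * k + 1) * w p := by
      intro k
      induction k with
      | zero => simp [hu0, hu1, u2, we p h0]
      | succ k ih =>
        obtain ⟨i1, i2⟩ := ih
        have e1 := wo (p + 2 * k + 1) (by omega)
        have e2 := we (p + 2 * k + 2) (by omega)
        have f1 := uo k
        have f2 := ue (k + 1)
        have f0 := ue k
        simp only [show p + 2 * (k + 1) = p + 2 * k + 2 by ring,
          show 2 * (k + 1) = 2 * k + 2 by ring, add_assoc, Nat.reduceAdd] at *
        have g : w (p + (2 * k + 3)) =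
            u (2 * k + 3) * w (p + 1) + c * (b / a * (u (2 * k + 2) * w p)) := by
          rw [e1, i1, i2, f1, f0]; field_simp; ring
        refine ⟨by rw [g]; ring, ?_⟩
        rw [e2, g, i2, f2, f1]; field_simp; ring
    rcases hk with rfl | rfl
    · have := (key k).1
      rw [show 2 * k + 1 + p = p + 2 * k + 1 by ring, this, h0,
        show (2 * k + 1) % 2 = 1 by omega, show (p + 1) % 2 = 1 by omega]
      simp
    · have := (key k).2
      rw [show 2 * k + 2 + p = p + 2 * k + 2 by ring, this, h0,
        show (2 * k + 2) % 2 = 0 by omega]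
      simp
  · have key : ∀ k, w (p + 2 * k + 1) = u (2 * k + 1) * w (p + 1) + c * u (2 * k) * w p ∧
        w (p + 2 * k + 2) = b / a * u (2 * k + 2) * w (p + 1) + c * u (2 * k + 1) * w p := by
      intro k
      induction k with
      | zero => simp [hu0, hu1, u2, wo p h1, ha]
      | succ k ih =>
        obtain ⟨i1, i2⟩ := ih
        have e1 := we (p + 2 * k + 1) (by omega)
        have e2 := wo (p + 2 * k + 2) (by omega)
        have f1 := uo k
        have f2 := ue (k + 1)
        have f0 := ue k
        simp only [show p + 2 * (k + 1) = p + 2 * k + 2 by ring,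
          show 2 * (k + 1) = 2 * k + 2 by ring, add_assoc, Nat.reduceAdd] at *
        have g : w (p + (2 * k + 3)) =
            u (2 * k + 3) * w (p + 1) + c * (u (2 * k + 2) * w p) := by
          rw [e1, i1, i2, f1, f0]; field_simp; ring
        refine ⟨by rw [g]; ring, ?_⟩
        rw [e2, g, i2, f2, f1]; field_simp; ring
    rcases hk with rfl | rfl
    · have := (key k).1
      rw [show 2 * k + 1 + p = p + 2 * k + 1 by ring, this, h1,
        show (2 * k + 1 + 1) % 2 = 0 by omega, show (p + 1) % 2 = 0 by omega]
      simp
    · have := (key k).2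
      rw [show 2 * k + 2 + p = p + 2 * k + 2 by ring, this, h1,
        show (2 * k + 2) % 2 = 0 by omega, show (2 * k + 2 + 1) % 2 = 1 by omega]
      simp
end

section
/- For all positive integers n, p and q, (b/a)^{ζ(n)·ζ(p)·ζ(q)}·w_{n+p}·w_{n+q} − (b/a)^{ζ(n+1)·ζ(p)·ζ(q)}·w_n·w_{n+p+q} = (b/a)^{ζ(n)·ζ(p+1)·ζ(q+1)}·(−c)^n·u_p·u_q·( w_1² − b·w_0·w_1 − (b/a)·c·w_0² ). -/
def FF (t c : ℝ) (u w : ℕ → ℝ) (D : ℝ) (n p q : ℕ) : Prop :=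
    t ^ (n % 2 * (p % 2) * (q % 2)) * w (n + p) * w (n + q) -
      t ^ ((n + 1) % 2 * (p % 2) * (q % 2)) * w n * w (n + p + q) =
      t ^ (n % 2 * ((p + 1) % 2) * ((q + 1) % 2)) * (-c) ^ n * u p * u q * D

lemma FF_symm {t c : ℝ} {u w : ℕ → ℝ} {D : ℝ} {n p q : ℕ} (h : FF t c u w D n p q) :
    FF t c u w D n q p := by
  unfold FF at *
  rw [show n + q + p = n + p + q by omega, mul_right_comm (n % 2) (q % 2),
    mul_right_comm ((n + 1) % 2) (q % 2), mul_right_comm (n % 2) ((q + 1) % 2)]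
  linear_combination h

lemma FF_step {t a c : ℝ} {u w : ℕ → ℝ} {D : ℝ} {n p q : ℕ}
    (hu : ∀ n : ℕ, u (n + 2) = (if n % 2 = 0 then a else t * a) * u (n + 1) + c * u n)
    (hw : ∀ n : ℕ, w (n + 2) = (if n % 2 = 0 then a else t * a) * w (n + 1) + c * w n)
    (h0 : FF t c u w D n p q) (h1 : FF t c u w D n (p + 1) q) :
    FF t c u w D n (p + 2) q := by
  unfold FF at *
  have e1 := hw (n + p)
  have e2 := hw (n + p + q)
  have e3 := hu p
  rw [show n + (p + 1) + q = n + p + q + 1 by omega, ← add_assoc n p 1] at h1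
  rw [show n + (p + 2) + q = n + p + q + 2 by omega, ← add_assoc n p 2]
  rw [e1, e2, e3]
  clear e1 e2 e3 hu hw
  generalize w (n + p + q + 1) = x1 at *
  generalize w (n + p + q) = x0 at *
  generalize w (n + p + 1) = y1 at *
  generalize w (n + p) = y0 at *
  generalize w (n + q) = z at *
  generalize (-c) ^ n = C at *
  rcases Nat.mod_two_eq_zero_or_one n with hn | hn <;>
  rcases Nat.mod_two_eq_zero_or_one p with hp | hp <;>
  rcases Nat.mod_two_eq_zero_or_one q with hq | hq <;>
  simp [Nat.add_mod, hn, hp, hq] at h0 h1 ⊢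
  · linear_combination (a) * h1 + c * h0
  · linear_combination (a) * h1 + c * h0
  · linear_combination (t * a) * h1 + c * h0
  · linear_combination (t * a) * h1 + c * h0
  · linear_combination (t * a) * h1 + c * h0
  · linear_combination (a) * h1 + c * h0
  · linear_combination (a) * h1 + c * h0
  · linear_combination (t * a) * h1 + c * h0

lemma FF_ind {t c : ℝ} {u w : ℕ → ℝ} {D : ℝ} {a : ℝ} {n q : ℕ}
    (hu : ∀ n : ℕ, u (n + 2) = (if n % 2 = 0 then a else t * a) * u (n + 1) + c * u n)
    (hw : ∀ n : ℕ, w (n + 2) = (if n % 2 = 0 then a else t * a) * w (n + 1) + c * w n)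
    (h0 : FF t c u w D n 0 q) (h1 : FF t c u w D n 1 q) (p : ℕ) :
    FF t c u w D n p q := by
  have : FF t c u w D n p q ∧ FF t c u w D n (p + 1) q := by
    induction p with
    | zero => exact ⟨h0, h1⟩
    | succ k ih => exact ⟨ih.2, FF_step hu hw ih.1 ih.2⟩
  exact this.1

lemma FF_zero {t c : ℝ} {u w : ℕ → ℝ} {D : ℝ} (n q : ℕ) (hu0 : u 0 = 0) :
    FF t c u w D n 0 q := by
  simp [FF, hu0]

lemma FF_one {t c : ℝ} {u w : ℕ → ℝ} {a : ℝ} (n : ℕ) (hu1 : u 1 = 1)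
    (hw : ∀ n : ℕ, w (n + 2) = (if n % 2 = 0 then a else t * a) * w (n + 1) + c * w n) :
    FF t c u w (w 1 ^ 2 - (t * a) * w 0 * w 1 - t * c * w 0 ^ 2) n 1 1 := by
  induction n with
  | zero =>
    have := hw 0
    simp [FF, hu1] at this ⊢
    rw [this]; ring
  | succ k ih =>
    unfold FF at *
    have e1 := hw k
    have e2 := hw (k + 1)
    rw [show k + 1 + 1 + 1 = k + 1 + 2 by omega, e2]
    rw [show k + 1 + 1 = k + 2 by omega] at *
    rw [pow_succ]
    rcases Nat.mod_two_eq_zero_or_one k with hk | hk <;>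
    simp [Nat.add_mod, hk, hu1] at ih e1 ⊢ <;>
    rw [e1] at ih ⊢ <;>
    linear_combination (-c) * ih

theorem stmt_16 (a b c : ℝ) (ha : a ≠ 0) (hb : b ≠ 0) (hc : c ≠ 0)
    (u : ℕ → ℝ) (hu0 : u 0 = 0) (hu1 : u 1 = 1)
    (hu : ∀ n : ℕ, 2 ≤ n → u n = (if Even n then a else b) * u (n - 1) + c * u (n - 2))
    (w : ℕ → ℝ)
    (hw : ∀ n : ℕ, 2 ≤ n → w n = (if Even n then a else b) * w (n - 1) + c * w (n - 2))
    (n p q : ℕ) (hn : 1 ≤ n) (hp : 1 ≤ p) (hq : 1 ≤ q) :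
    (b / a) ^ (n % 2 * (p % 2) * (q % 2)) * w (n + p) * w (n + q) -
      (b / a) ^ ((n + 1) % 2 * (p % 2) * (q % 2)) * w n * w (n + p + q) =
      (b / a) ^ (n % 2 * ((p + 1) % 2) * ((q + 1) % 2)) * (-c) ^ n * u p * u q *
        (w 1 ^ 2 - b * w 0 * w 1 - b / a * c * w 0 ^ 2) := by
  have hb' : b = b / a * a := by field_simp
  generalize b / a = t at *
  subst hb'
  have hu' : ∀ n : ℕ, u (n + 2) = (if n % 2 = 0 then a else t * a) * u (n + 1) + c * u n := by
    intro n
    have := hu (n + 2) (by omega)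
    simpa [Nat.even_iff] using this
  have hw' : ∀ n : ℕ, w (n + 2) = (if n % 2 = 0 then a else t * a) * w (n + 1) + c * w n := by
    intro n
    have := hw (n + 2) (by omega)
    simpa [Nat.even_iff] using this
  exact FF_ind hu' hw' (FF_zero n q hu0)
    (FF_symm (FF_ind hu' hw' (FF_zero n 1 hu0) (FF_one n hu1 hw') q)) p
end

section
/- For all positive integers n and m, (b/a)^{ζ(mn+n)}·w_{n+1}·w_m + (b/a)^{ζ(mn+m)}·c·w_n·w_{m−1} = w_1·w_{m+n} + (b/a)^{ζ(m+n)}·c·w_0·w_{m+n−1}. -/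
theorem stmt_17_aux (a b c : ℝ) (ha : a ≠ 0)
    (w : ℕ → ℝ)
    (hw : ∀ n : ℕ, w (n + 2) = (if n % 2 = 0 then a else b) * w (n + 1) + c * w n)
    (n : ℕ) : ∀ k : ℕ,
    (b / a) ^ (((k + 1) * n + n) % 2) * w (n + 1) * w (k + 1) +
      (b / a) ^ (((k + 1) * n + (k + 1)) % 2) * c * w n * w k =
      w 1 * w (k + 1 + n) + (b / a) ^ ((k + 1 + n) % 2) * c * w 0 * w (k + n) := by
  induction n with
  | zero => intro k; simp
  | succ n ih =>
    intro k
    have h := ih (k + 1)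
    have e1 : k + 1 + 1 + n = k + 1 + (n + 1) := by ring
    have e2 : k + 1 + n = k + (n + 1) := by ring
    rw [e1, e2] at h
    rw [← h, show n + 1 + 1 = n + 2 from rfl, show k + 1 + 1 = k + 2 from rfl, hw n, hw k]
    rcases Nat.mod_two_eq_zero_or_one n with hn | hn <;>
    rcases Nat.mod_two_eq_zero_or_one k with hk | hk <;>
    simp [Nat.add_mod, Nat.mul_mod, hn, hk] <;> field_simp <;> ring

theorem stmt_17 (a b c : ℝ) (ha : a ≠ 0) (hb : b ≠ 0) (hc : c ≠ 0)
    (w : ℕ → ℝ)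
    (hw : ∀ n : ℕ, 2 ≤ n → w n = (if Even n then a else b) * w (n - 1) + c * w (n - 2))
    (n m : ℕ) (hn : 1 ≤ n) (hm : 1 ≤ m) :
    (b / a) ^ ((m * n + n) % 2) * w (n + 1) * w m +
      (b / a) ^ ((m * n + m) % 2) * c * w n * w (m - 1) =
      w 1 * w (m + n) + (b / a) ^ ((m + n) % 2) * c * w 0 * w (m + n - 1) := by
  obtain ⟨k, rfl⟩ : ∃ k, m = k + 1 := ⟨m - 1, by omega⟩
  have h := stmt_17_aux a b c ha w (fun n => by
    have h := hw (n + 2) (by omega)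
    simpa [Nat.even_iff] using h) n k
  have e : k + 1 + n - 1 = k + n := by omega
  rw [e, Nat.add_sub_cancel]
  exact h
end

section
/- For every positive integer n, (b/a)^{ζ(n)}·w_{n+1}² + (b/a)^{ζ(n+1)}·c·w_n² = w_1·w_{2n+1} + (b/a)·c·w_0·w_{2n}. -/
theorem stmt_18 (a b c : ℝ) (ha : a ≠ 0) (hb : b ≠ 0) (hc : c ≠ 0)
    (w : ℕ → ℝ)
    (hw : ∀ n : ℕ, 2 ≤ n → w n = (if Even n then a else b) * w (n - 1) + c * w (n - 2))
    (n : ℕ) (hn : 1 ≤ n) :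
    (b / a) ^ (n % 2) * w (n + 1) ^ 2 + (b / a) ^ ((n + 1) % 2) * c * w n ^ 2 =
      w 1 * w (2 * n + 1) + b / a * c * w 0 * w (2 * n) := by
  have he : ∀ j : ℕ, w (2 * j + 2) = a * w (2 * j + 1) + c * w (2 * j) := by
    intro j
    have h := hw (2 * j + 2) (by omega)
    rw [if_pos ⟨j + 1, by ring⟩] at h
    exact h
  have ho : ∀ j : ℕ, w (2 * j + 3) = b * w (2 * j + 2) + c * w (2 * j + 1) := by
    intro j
    have h := hw (2 * j + 3) (by omega)
    rw [if_neg (by rw [Nat.not_even_iff_odd]; exact ⟨j + 1, by ring⟩)] at h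
    exact h
  obtain ⟨r, hr⟩ : ∃ r, r = b / a := ⟨_, rfl⟩
  have hb' : b = r * a := by rw [hr]; field_simp
  rw [← hr]
  -- half a shift of the bilinear form
  have mid : ∀ i j : ℕ, w (2 * i + 1) * w (2 * j + 3) + r * c * w (2 * i) * w (2 * j + 2)
      = r * w (2 * i + 2) * w (2 * j + 2) + c * w (2 * i + 1) * w (2 * j + 1) := by
    intro i j
    rw [ho j, he i, hb']
    ring
  have key : ∀ i j : ℕ, w (2 * i + 1) * w (2 * j + 1) + r * c * w (2 * i) * w (2 * j)
      = w 1 * w (2 * (i + j) + 1) + r * c * w 0 * w (2 * (i + j)) := by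
    intro i
    induction i with
    | zero => intro j; simp
    | succ i ih =>
      intro j
      have h1 := ih (j + 1)
      rw [show i + (j + 1) = i + 1 + j by ring] at h1
      rw [← h1]
      have h2 := mid i j
      have h3 := mid j i
      simp only [show 2 * (i + 1) = 2 * i + 2 by ring, show 2 * (j + 1) = 2 * j + 2 by ring,
        show 2 * i + 2 + 1 = 2 * i + 3 by ring, show 2 * j + 2 + 1 = 2 * j + 3 by ring]
      linarith
  rcases Nat.even_or_odd' n with ⟨i, rfl | rfl⟩
  · have h := key i i
    rw [show i + i = 2 * i by ring] at h
    rw [← h, show 2 * i % 2 = 0 by omega, show (2 * i + 1) % 2 = 1 by omega]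
    ring
  · have h := key i (i + 1)
    rw [show i + (i + 1) = 2 * i + 1 by ring] at h
    rw [← h, show (2 * i + 1) % 2 = 1 by omega, show (2 * i + 1 + 1) % 2 = 0 by omega]
    have h2 := mid i i
    simp only [show 2 * (i + 1) = 2 * i + 2 by ring, show 2 * i + 2 + 1 = 2 * i + 3 by ring,
      show 2 * i + 1 + 1 = 2 * i + 2 by ring]
    linarith
end

section
/- For every positive integer n, w_{n+1}² − c²·w_{n−1}² = a^{ζ(n)}·b^{ζ(n+1)}·( w_1·w_{2n} + c·w_0·w_{2n−1} ). -/
theorem stmt_19 (a b c : ℝ) (ha : a ≠ 0) (hb : b ≠ 0) (hc : c ≠ 0)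
    (w : ℕ → ℝ)
    (hw : ∀ n : ℕ, 2 ≤ n → w n = (if Even n then a else b) * w (n - 1) + c * w (n - 2))
    (n : ℕ) (hn : 1 ≤ n) :
    w (n + 1) ^ 2 - c ^ 2 * w (n - 1) ^ 2 =
      a ^ (n % 2) * b ^ ((n + 1) % 2) * (w 1 * w (2 * n) + c * w 0 * w (2 * n - 1)) := by
  have hs : ∀ k : ℕ, w (k + 2) = (if Even k then a else b) * w (k + 1) + c * w k := by
    intro k
    have h := hw (k + 2) (by omega)
    have e : Even (k + 2) ↔ Even k := by simp [Nat.even_add]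
    simpa [e] using h
  have key : ∀ m k : ℕ, Even (m + k) →
      w (m + 1) * w (k + 2) + c * w m * w (k + 1)
        = w 1 * w (m + k + 2) + c * w 0 * w (m + k + 1) := by
    intro m
    induction m with
    | zero => intro k _; simp
    | succ m ih =>
      intro k hk
      have h := ih (k + 1) (by rwa [show m + (k + 1) = m + 1 + k by omega])
      rw [show m + (k + 1) = m + 1 + k by omega] at h
      rw [← h]
      have h1 := hs m
      have h2 := hs (k + 1)
      have e : Even m ↔ Even (k + 1) := by
        rw [← Nat.even_add]
        rwa [show m + (k + 1) = m + 1 + k by omega]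
      simp only [e] at h1
      simp only [show k + 1 + 2 = k + 3 by omega, show k + 1 + 1 = k + 2 by omega,
        show m + 1 + 1 = m + 2 by omega] at *
      rw [h1, h2]
      ring
  obtain ⟨N, rfl⟩ : ∃ N, n = N + 1 := ⟨n - 1, by omega⟩
  have h := key N N ⟨N, rfl⟩
  rw [show 2 * (N + 1) = N + N + 2 by omega, show N + N + 2 - 1 = N + N + 1 by omega, ← h]
  simp only [show N + 1 + 1 = N + 2 by omega, show N + 1 - 1 = N by omega]
  have h1 := hs N
  have hp : a ^ ((N + 1) % 2) * b ^ ((N + 2) % 2) = if Even N then a else b := by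
    rcases Nat.even_or_odd N with h | h
    · have := Nat.even_iff.1 h
      rw [if_pos h, show (N + 1) % 2 = 1 by omega, show (N + 2) % 2 = 0 by omega]
      simp
    · have := Nat.odd_iff.1 h
      rw [if_neg (Nat.not_even_iff_odd.2 h), show (N + 1) % 2 = 0 by omega,
        show (N + 2) % 2 = 1 by omega]
      simp
  rw [hp]
  linear_combination (w (N + 2) + c * w N) * h1
end
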